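/- For every simple left I₁-module M, the endomorphism ring End_{I₁}(M) is a finite-dimensional K-vector space (hence a finite-dimensional division K-algebra). -/

import Mathlib

open Polynomial

noncomputable section
set_option synthInstance.maxHeartbeats 1000000
set_option maxHeartbeats 1000000
set_option linter.unusedSectionVars false

variable (K : Type*) [Field K] [CharZero K]

/-- The derivative operator `∂ = d/dx` on `K[x]`. -/
def derOp : Module.End K (Polynomial K) := Polynomial.derivative

/-- The multiplication-by-`x` operator on `K[x]`. -/
def xOp : Module.End K (Polynomial K) := LinearMap.mulLeft K Polynomial.X

/-- The integration operator `∫`, determined by `∫ xⁿ = xⁿ⁺¹/(n+1)`. -/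
def intOp : Module.End K (Polynomial K) :=
  (Polynomial.basisMonomials K).constr K fun n => ((n : K) + 1)⁻¹ • X ^ (n + 1)

/-- The algebra `I₁` of polynomial integro-differential operators: the subalgebra of
`End_K(K[x])` generated by `x`, `∂` and `∫`. -/
def I1 : Subalgebra K (Module.End K (Polynomial K)) :=
  Algebra.adjoin K {xOp K, derOp K, intOp K}

/-- `e_{ij} := ∫^i ∂^j − ∫^{i+1} ∂^{j+1}`. -/
def eOp (i j : ℕ) : Module.End K (Polynomial K) :=
  intOp K ^ i * derOp K ^ j - intOp K ^ (i + 1) * derOp K ^ (j + 1)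

/-- `F`, the `K`-linear span of the `e_{ij}`; it is the (two-sided) ideal of compact
operators of `I₁`. -/
def Fset : Submodule K (Module.End K (Polynomial K)) :=
  Submodule.span K {f | ∃ i j, f = eOp K i j}

lemma xOp_mem : xOp K ∈ I1 K := Algebra.subset_adjoin (by simp)
lemma derOp_mem : derOp K ∈ I1 K := Algebra.subset_adjoin (by simp)
lemma intOp_mem : intOp K ∈ I1 K := Algebra.subset_adjoin (by simp)

lemma eOp_mem (i j : ℕ) : eOp K i j ∈ I1 K :=
  sub_mem (mul_mem (pow_mem (intOp_mem K) i) (pow_mem (derOp_mem K) j))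
    (mul_mem (pow_mem (intOp_mem K) (i + 1)) (pow_mem (derOp_mem K) (j + 1)))

/-- `e_{ij}` as an element of the ring `I₁`. -/
def eI (i j : ℕ) : I1 K := ⟨eOp K i j, eOp_mem K i j⟩

/-- `∂` as an element of the ring `I₁`. -/
def derI : I1 K := ⟨derOp K, derOp_mem K⟩

/-- `∫` as an element of the ring `I₁`. -/
def intI : I1 K := ⟨intOp K, intOp_mem K⟩

/-- `H := ∂ ∘ x` (first multiply by `x`, then differentiate). -/
def hOp : Module.End K (Polynomial K) := derOp K * xOp K

/-- `K[H]`, the unital subalgebra of `I₁` generated by `H`. -/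
def KH : Subalgebra K (Module.End K (Polynomial K)) := Algebra.adjoin K {hOp K}

/-- The action of `a ∈ I₁` on a left `I₁`-module `M`, as a `K`-linear map `a_M : M → M`. -/
def actMap (a : I1 K) (M : Type*) [AddCommGroup M] [Module (I1 K) M] [Module K M]
    [SMulCommClass K (I1 K) M] : M →ₗ[K] M where
  toFun m := a • m
  map_add' := smul_add a
  map_smul' k m := (smul_comm k a m).symm

/-- Right multiplication `b ↦ b * a` in a ring `R`, as a homomorphism of left `R`-modules. -/
def rmulMap (R : Type*) [Ring R] (a : R) : R →ₗ[R] R where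
  toFun b := b * a
  map_add' b c := add_mul b c a
  map_smul' c b := by simp [smul_eq_mul, mul_assoc]

/-- Left multiplication `b ↦ a * b` in a ring `R`, as a homomorphism of right `R`-modules
(i.e. of left `Rᵐᵒᵖ`-modules). -/
def lmulMap (R : Type*) [Ring R] (a : R) : R →ₗ[Rᵐᵒᵖ] R where
  toFun b := a * b
  map_add' b c := mul_add a b c
  map_smul' c b := by simp [MulOpposite.smul_eq_mul_unop, mul_assoc]

/-- The centralizer `Cen_{I₁}(a) = {b ∈ I₁ : ab = ba}` of `a` in `I₁`, as a subalgebra of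
`End_K(K[x])`. -/
def Cen (a : Module.End K (Polynomial K)) : Subalgebra K (Module.End K (Polynomial K)) :=
  I1 K ⊓ Subalgebra.centralizer K {a}

/-- `Cen_F(a) = {f ∈ F : af = fa}`, a `K`-subspace of `End_K(K[x])`. -/
def CenF (a : Module.End K (Polynomial K)) : Submodule K (Module.End K (Polynomial K)) :=
  Fset K ⊓ Subalgebra.toSubmodule (Subalgebra.centralizer K {a})

namespace ShiftModule

section Polynomials

variable {k : Type*} [Field k] [CharZero k]

lemma eq_C_mul_of_taylor_mul_eq {c : k} (hc : c ≠ 0) {p q : k[X]} (hp : p ≠ 0)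
    (h : taylor c q * p = taylor c p * q) : ∃ a : k, q = C a * p := by
  have hinj : Function.Injective fun n : ℕ => (n : k) * c := fun m n hmn =>
    Nat.cast_injective (mul_right_cancel₀ hc hmn)
  have hfin : {n : ℕ | p.eval ((n : k) * c) = 0}.Finite :=
    (p.finite_setOfPred_isRoot hp).preimage hinj.injOn
  obtain ⟨N, hN⟩ := hfin.bddAbove
  have hne : ∀ n, N < n → p.eval ((n : k) * c) ≠ 0 := fun n hn h0 =>
    absurd (hN h0) (not_le.mpr hn)
  refine ⟨q.eval (((N + 1 : ℕ) : k) * c) / p.eval (((N + 1 : ℕ) : k) * c), ?_⟩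
  refine eq_of_infinite_eval_eq _ _
    (((Set.Ici_infinite (N + 1)).image hinj.injOn).mono ?_)
  rintro _ ⟨n, hn, rfl⟩
  simp only [Set.mem_Ici] at hn
  simp only [Set.mem_ofPred_eq, eval_mul, eval_C]
  induction n, hn using Nat.le_induction with
  | base => rw [div_mul_cancel₀ _ (hne _ (Nat.lt_succ_self N))]
  | succ n hn ih =>
    have h1 := congrArg (eval ((n : k) * c)) h
    simp only [eval_mul, taylor_eval] at h1
    have h2 : ((n + 1 : ℕ) : k) * c = n * c + c := by push_cast; ring
    rw [h2]
    apply mul_right_cancel₀ (hne n (Nat.lt_of_succ_le hn))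
    rw [h1, ih]
    ring

lemma isCoprime_taylor_of_irreducible {c : k} (hc : c ≠ 0) {p : k[X]} (hp : Irreducible p) :
    IsCoprime (taylor c p) p := by
  refine IsCoprime.symm ((hp.coprime_iff_not_dvd).mpr ?_)
  rintro ⟨q, hq⟩
  have ht : taylor c p ≠ 0 := by simpa using hp.ne_zero
  have hq0 : q ≠ 0 := by rintro rfl; exact ht (by simpa using hq)
  have hdeg : q.natDegree = 0 := by
    have := congrArg natDegree hq
    rw [natDegree_taylor, natDegree_mul hp.ne_zero hq0] at this
    omega
  have hlead : q.leadingCoeff = 1 := by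
    have := congrArg leadingCoeff hq
    rw [leadingCoeff_taylor, leadingCoeff_mul] at this
    exact (mul_eq_left₀ (leadingCoeff_ne_zero.mpr hp.ne_zero)).mp this.symm
  have hq1 : q = 1 := eq_one_of_monic_natDegree_zero hlead hdeg
  rw [hq1, mul_one] at hq
  obtain ⟨a, ha⟩ := eq_C_mul_of_taylor_mul_eq hc (p := 1) (q := p) one_ne_zero (by simp [hq])
  rw [mul_one] at ha
  apply hp.not_isUnit
  rw [ha, isUnit_C]
  exact isUnit_iff_ne_zero.mpr fun h0 => hp.ne_zero (by rw [ha, h0, C_0])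

end Polynomials

variable {k M : Type*} [Field k] [CharZero k] [AddCommGroup M] [Module k M] [Module k[X] M]
  [IsScalarTower k k[X] M]

lemma zpow_smul {u : M ≃ₗ[k] M} (hu : ∀ (p : k[X]) (v : M), u (p • v) = taylor 1 p • u v)
    (i : ℤ) (p : k[X]) (v : M) : (u ^ i) (p • v) = taylor (i : k) p • (u ^ i) v := by
  have hu' : ∀ (p : k[X]) (v : M), u⁻¹ (p • v) = taylor (-1) p • u⁻¹ v := fun p v => by
    apply u.injective
    rw [hu, taylor_taylor, add_neg_cancel, taylor_zero]
    change u (u.symm _) = p • u (u.symm _)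
    simp
  induction i using Int.induction_on generalizing p v with
  | zero => simp
  | succ n ih =>
    rw [zpow_add_one, LinearEquiv.mul_apply, LinearEquiv.mul_apply, hu, ih, taylor_taylor]
    push_cast; rfl
  | pred n ih =>
    rw [zpow_sub_one, LinearEquiv.mul_apply, LinearEquiv.mul_apply, hu', ih, taylor_taylor,
      Int.cast_sub, Int.cast_one, sub_eq_add_neg]

/-- A module over `k[X]` with a `k`-linear automorphism `u` satisfying `u X = (X + 1) u`, which is
simple as such. -/
structure IsSimpleShift (u : M ≃ₗ[k] M) : Prop where
  smul : ∀ (p : k[X]) (v : M), u (p • v) = taylor 1 p • u v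
  eq_top : ∀ N : Submodule k[X] M, N ≠ ⊥ → (∀ v ∈ N, u v ∈ N) → (∀ v ∈ N, u⁻¹ v ∈ N) → N = ⊤

variable {u : M ≃ₗ[k] M}

lemma IsSimpleShift.smul_inv (hu : IsSimpleShift u) (p : k[X]) (v : M) :
    u⁻¹ (p • v) = taylor (-1) p • u⁻¹ v := by
  simpa using zpow_smul hu.smul (-1) p v

lemma IsSimpleShift.span_zpow_eq_top (hu : IsSimpleShift u) {v : M} (hv : v ≠ 0) :
    Submodule.span k[X] (Set.range fun i : ℤ => (u ^ i) v) = ⊤ := by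
  apply hu.eq_top
  · refine (Submodule.ne_bot_iff _).mpr ⟨v, Submodule.subset_span ⟨0, by simp⟩, hv⟩
  · intro w hw
    induction hw using Submodule.span_induction with
    | mem x hx =>
      obtain ⟨i, rfl⟩ := hx
      refine Submodule.subset_span ⟨1 + i, ?_⟩
      simp [zpow_add, LinearEquiv.mul_apply]
    | zero => simp
    | add x y _ _ hx hy => rw [map_add]; exact add_mem hx hy
    | smul p x _ hx => rw [hu.smul]; exact Submodule.smul_mem _ _ hx
  · intro w hw
    induction hw using Submodule.span_induction with
    | mem x hx =>
      obtain ⟨i, rfl⟩ := hx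
      refine Submodule.subset_span ⟨-1 + i, ?_⟩
      simp [zpow_add, LinearEquiv.mul_apply]
    | zero => simp
    | add x y _ _ hx hy => rw [map_add]; exact add_mem hx hy
    | smul p x _ hx => rw [hu.smul_inv]; exact Submodule.smul_mem _ _ hx

lemma IsSimpleShift.eq_zero_of_apply_eq_zero (hu : IsSimpleShift u) {φ : M →ₗ[k[X]] M}
    (hφ : ∀ v, φ (u v) = u (φ v)) {v : M} (hv : v ≠ 0) (h : φ v = 0) : φ = 0 := by
  rw [← LinearMap.ker_eq_top]
  apply hu.eq_top
  · exact (Submodule.ne_bot_iff _).mpr ⟨v, h, hv⟩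
  · intro w hw
    rw [LinearMap.mem_ker] at hw ⊢
    rw [hφ, hw, map_zero]
  · intro w hw
    rw [LinearMap.mem_ker] at hw ⊢
    apply u.injective
    rw [← hφ]
    change φ (u (u.symm w)) = u 0
    rw [u.apply_symm_apply, hw, map_zero]

lemma exists_irreducible_smul_eq_zero {p : k[X]} (hp : p ≠ 0) {v : M} (hv : v ≠ 0)
    (h : p • v = 0) : ∃ (π : k[X]) (w : M), Irreducible π ∧ w ≠ 0 ∧ π • w = 0 := by
  induction p using WfDvdMonoid.induction_on_irreducible generalizing v with
  | zero => exact absurd rfl hp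
  | unit q hq => exact absurd ((hq.smul_eq_zero).mp h) hv
  | mul a i ha hi ih =>
    by_cases h0 : a • v = 0
    · exact ih ha hv h0
    · exact ⟨i, a • v, hi, h0, by rwa [← mul_smul]⟩

/-- The elements annihilated by a polynomial coprime to `p`. -/
def coprimeTorsion (M : Type*) [AddCommGroup M] [Module k[X] M] (p : k[X]) :
    Submodule k[X] M where
  carrier := {n | ∃ q : k[X], IsCoprime q p ∧ q • n = 0}
  zero_mem' := ⟨1, isCoprime_one_left, smul_zero _⟩
  add_mem' := by
    rintro a b ⟨q, hq, ha⟩ ⟨r, hr, hb⟩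
    refine ⟨q * r, hq.mul_left hr, ?_⟩
    rw [smul_add, mul_comm, mul_smul, ha, mul_comm, mul_smul, hb, smul_zero, smul_zero, add_zero]
  smul_mem' := by
    rintro c a ⟨q, hq, ha⟩
    exact ⟨q, hq, by rw [smul_comm, ha, smul_zero]⟩

lemma IsSimpleShift.exists_smul_of_irreducible (hu : IsSimpleShift u) {p : k[X]}
    (hp : Irreducible p) {v w : M} (hv : v ≠ 0) (hpv : p • v = 0) (hpw : p • w = 0) :
    ∃ q : k[X], w = q • v := by
  have htop : Submodule.span k[X] {v} ⊔ coprimeTorsion M p = ⊤ := by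
    rw [eq_top_iff, ← hu.span_zpow_eq_top hv, Submodule.span_le]
    rintro _ ⟨i, rfl⟩
    rcases eq_or_ne i 0 with rfl | hi
    · exact Submodule.mem_sup_left (Submodule.subset_span (by simp))
    · refine Submodule.mem_sup_right ⟨taylor (i : k) p, ?_, ?_⟩
      · exact isCoprime_taylor_of_irreducible (Int.cast_ne_zero.mpr hi) hp
      · simp only [← zpow_smul hu.smul, hpv, map_zero]
  obtain ⟨a, ha, n, ⟨q, ⟨r, s, hrs⟩, hqn⟩, hw⟩ :=
    Submodule.mem_sup.mp (htop ▸ Submodule.mem_top : w ∈ Submodule.span k[X] {v} ⊔ _)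
  obtain ⟨t, rfl⟩ := Submodule.mem_span_singleton.mp ha
  have hpn : p • n = 0 := by
    rw [← hw, smul_add, smul_comm, hpv, smul_zero, zero_add] at hpw
    exact hpw
  have hn : n = 0 := by
    rw [← one_smul k[X] n, ← hrs, add_smul, mul_smul, mul_smul, hqn, hpn]
    simp
  exact ⟨t, by rw [← hw, hn, add_zero]⟩

lemma IsSimpleShift.finite_of_torsion (hu : IsSimpleShift u) {p : k[X]} (hp : p ≠ 0) {v : M}
    (hv : v ≠ 0) (h : p • v = 0) (D : Submodule k (M →ₗ[k[X]] M))
    (hD : ∀ φ ∈ D, ∀ v, φ (u v) = u (φ v)) : Module.Finite k D := by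
  obtain ⟨π, w, hπ, hw, h0⟩ := exists_irreducible_smul_eq_zero hp hv h
  let ev : D →ₗ[k] M :=
    { toFun := fun φ => (φ : M →ₗ[k[X]] M) w
      map_add' := fun _ _ => rfl
      map_smul' := fun _ _ => rfl }
  let T : Submodule k M := (degreeLT k π.natDegree).map
    ((LinearMap.toSpanSingleton k[X] M w).restrictScalars k)
  have hT : ∀ φ, ev φ ∈ T := by
    intro φ
    obtain ⟨q, hq⟩ := hu.exists_smul_of_irreducible hπ (v := w) (w := ev φ) hw h0 (by
      change π • (φ : M →ₗ[k[X]] M) w = 0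
      rw [← map_smul, h0, map_zero])
    refine ⟨q % π, ?_, ?_⟩
    · rw [SetLike.mem_coe, mem_degreeLT, ← degree_eq_natDegree hπ.ne_zero]
      exact EuclideanDomain.mod_lt q hπ.ne_zero
    · rw [hq]
      conv_rhs => rw [← EuclideanDomain.div_add_mod q π]
      rw [add_smul, mul_comm, mul_smul, h0, smul_zero, zero_add]
      rfl
  refine Module.Finite.of_injective (ev.codRestrict T hT) ?_
  rw [← LinearMap.ker_eq_bot, LinearMap.ker_codRestrict, LinearMap.ker_eq_bot']
  rintro ⟨φ, hφ⟩ h1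
  exact Subtype.ext (hu.eq_zero_of_apply_eq_zero (hD φ hφ) hw h1)

lemma IsSimpleShift.linearIndependent_polynomial (hu : IsSimpleShift u)
    (ht : ∀ (p : k[X]) (v : M), p • v = 0 → p = 0 ∨ v = 0) {ι : Type*} {φ : ι → (M →ₗ[k[X]] M)}
    (hφ : ∀ i v, φ i (u v) = u (φ i v)) (hli : LinearIndependent k φ) :
    LinearIndependent k[X] φ := by
  classical
  rw [linearIndependent_iff'] at hli ⊢
  intro s
  induction s using Finset.induction_on with
  | empty => simp
  | insert j s hj ih =>
    intro p hp
    have key : ∀ v, p j • φ j v + ∑ i ∈ s, p i • φ i v = 0 := fun v => by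
      have := LinearMap.congr_fun hp v
      simpa [Finset.sum_insert hj, LinearMap.sum_apply] using this
    by_cases hpj : p j = 0
    · have := ih p (by ext v; simpa [hpj, LinearMap.sum_apply] using key v)
      simpa [hpj] using this
    exfalso
    have key' : ∀ v, taylor 1 (p j) • φ j v + ∑ i ∈ s, taylor 1 (p i) • φ i v = 0 := fun v => by
      have := congrArg u (key (u⁻¹ v))
      have hv : u (u⁻¹ v) = v := u.apply_symm_apply v
      simpa only [map_add, map_sum, hu.smul, ← hφ, hv, map_zero] using this
    have hzero := ih (fun i => taylor 1 (p i) * p j - taylor 1 (p j) * p i) (by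
      ext v
      have h1 := congrArg (p j • ·) (key' v)
      have h2 := congrArg (taylor 1 (p j) • ·) (key v)
      simp only [smul_add, Finset.smul_sum, smul_zero, ← mul_smul] at h1 h2
      rw [mul_comm] at h1
      have h3 := sub_eq_zero.mpr (h1.trans h2.symm)
      rw [add_sub_add_left_eq_sub, ← Finset.sum_sub_distrib] at h3
      simpa [LinearMap.sum_apply, sub_smul, mul_comm] using h3)
    have hex : ∀ i, ∃ a : k, i ∈ s → p i = C a * p j := fun i => by
      by_cases hi : i ∈ s
      · obtain ⟨a, ha⟩ := eq_C_mul_of_taylor_mul_eq one_ne_zero hpj (sub_eq_zero.mp (hzero i hi))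
        exact ⟨a, fun _ => ha⟩
      · exact ⟨0, fun h => absurd h hi⟩
    choose a ha using hex
    have hrel : ∑ i ∈ insert j s, (if i = j then 1 else a i) • φ i = 0 := by
      ext v
      have hs : ∑ i ∈ s, (if i = j then 1 else a i) • φ i v = ∑ i ∈ s, a i • φ i v :=
        Finset.sum_congr rfl fun i hi => by rw [if_neg (ne_of_mem_of_not_mem hi hj)]
      have hmul : p j • (φ j v + ∑ i ∈ s, a i • φ i v) = 0 := by
        rw [← key v, smul_add, Finset.smul_sum]
        congr 1
        refine Finset.sum_congr rfl fun i hi => ?_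
        rw [ha i hi, mul_comm, mul_smul, ← algebraMap_smul k[X] (a i) (φ i v)]
        rfl
      have := (ht _ _ hmul).resolve_left hpj
      simpa only [Finset.sum_insert hj, LinearMap.add_apply, LinearMap.sum_apply,
        LinearMap.smul_apply, hs, if_true, one_smul, LinearMap.zero_apply] using this
    have := hli _ _ hrel j (Finset.mem_insert_self j s)
    simp at this

/-- The elements having a nonzero multiple in `S`. -/
def isolator {R P : Type*} [CommRing R] [IsDomain R] [AddCommGroup P] [Module R P]
    (S : Submodule R P) : Submodule R P where
  carrier := {n | ∃ q : R, q ≠ 0 ∧ q • n ∈ S}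
  zero_mem' := ⟨1, one_ne_zero, by simp⟩
  add_mem' := by
    rintro a b ⟨q, hq, ha⟩ ⟨r, hr, hb⟩
    refine ⟨q * r, mul_ne_zero hq hr, ?_⟩
    rw [smul_add]
    refine add_mem ?_ ?_
    · rw [mul_comm, mul_smul]; exact S.smul_mem _ ha
    · rw [mul_smul]; exact S.smul_mem _ hb
  smul_mem' := by
    rintro c a ⟨q, hq, ha⟩
    exact ⟨q, hq, by rw [smul_comm]; exact S.smul_mem _ ha⟩

lemma rank_lt_aleph0_of_isolator_eq_top {R P : Type*} [CommRing R] [IsDomain R] [AddCommGroup P]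
    [Module R P] {S : Submodule R P} (hS : S.FG) (h : isolator S = ⊤) :
    Module.rank R P < Cardinal.aleph0 := by
  have hq : Module.rank R (P ⧸ S) = 0 := by
    rw [rank_eq_zero_iff]
    intro x
    obtain ⟨y, rfl⟩ := S.mkQ_surjective x
    obtain ⟨q, hq, hy⟩ := (h ▸ Submodule.mem_top : y ∈ isolator S)
    exact ⟨q, hq, by
      rw [← map_smul, Submodule.mkQ_apply, (Submodule.Quotient.mk_eq_zero S).mpr hy]⟩
  rw [← rank_quotient_add_rank_of_isDomain S, hq, zero_add]
  have : Module.Finite R S := Module.Finite.iff_fg.mpr hS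
  exact Module.rank_lt_aleph0 R S

lemma isolator_pi_eq_top {R P ι : Type*} [CommRing R] [IsDomain R] [AddCommGroup P] [Module R P]
    [Finite ι] {S : Submodule R P} (h : isolator S = ⊤) :
    isolator (Submodule.pi Set.univ fun _ : ι => S) = ⊤ := by
  have := Fintype.ofFinite ι
  classical
  rw [eq_top_iff]
  intro f _
  have hf : ∀ i, f i ∈ isolator S := fun i => h ▸ Submodule.mem_top
  choose q hq hqf using hf
  refine ⟨∏ i, q i, Finset.prod_ne_zero_iff.mpr fun i _ => hq i, ?_⟩
  intro i _
  rw [Pi.smul_apply, ← Finset.prod_erase_mul _ _ (Finset.mem_univ i), mul_smul]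
  exact S.smul_mem _ (hqf i)

lemma IsSimpleShift.exists_relation (hu : IsSimpleShift u)
    (ht : ∀ (p : k[X]) (v : M), p • v = 0 → p = 0 ∨ v = 0) {v : M} (hv : v ≠ 0) :
    ∃ q : ℤ →₀ k[X], q ≠ 0 ∧ ∑ i ∈ q.support, q i • (u ^ i) v = 0 := by
  have hXv : (X : k[X]) • v ≠ 0 := fun h => (ht _ _ h).elim X_ne_zero hv
  obtain ⟨c, hc⟩ := Finsupp.mem_span_range_iff_exists_finsupp.mp
    (hu.span_zpow_eq_top hXv ▸ Submodule.mem_top : v ∈ Submodule.span k[X] _)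
  let d : ℤ →₀ k[X] := Finsupp.onFinset c.support (fun i => c i * taylor (i : k) X) fun i h =>
    Finsupp.mem_support_iff.mpr (left_ne_zero_of_mul h)
  refine ⟨d - Finsupp.single 0 1, fun h0 => ?_, ?_⟩
  · have h1 := congrArg (eval 0) (DFunLike.congr_fun h0 0)
    simp [d] at h1
  · change (d - Finsupp.single 0 1).sum (fun i p => p • (u ^ i) v) = 0
    have hd : d.sum (fun i p => p • (u ^ i) v) = v := by
      have hsum : d.sum (fun i p => p • (u ^ i) v) = ∑ i ∈ c.support, d i • (u ^ i) v :=
        Finsupp.sum_of_support_subset d Finsupp.support_onFinset_subset _ (by simp)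
      rw [hsum]
      rw [Finsupp.sum] at hc
      conv_rhs => rw [← hc]
      refine Finset.sum_congr rfl fun i _ => ?_
      rw [zpow_smul hu.smul, ← mul_smul]
      rfl
    rw [Finsupp.sum_sub_index (fun _ _ _ => sub_smul _ _ _), Finsupp.sum_single_index (by simp),
      hd, zpow_zero, LinearEquiv.coe_one, id, one_smul, sub_self]

lemma IsSimpleShift.exists_fg_isolator_eq_top [Nontrivial M] (hu : IsSimpleShift u)
    (ht : ∀ (p : k[X]) (v : M), p • v = 0 → p = 0 ∨ v = 0) :
    ∃ s : Finset M, isolator (Submodule.span k[X] (s : Set M)) = ⊤ := by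
  classical
  obtain ⟨v, hv⟩ := exists_ne (0 : M)
  obtain ⟨q, hq0, hq⟩ := hu.exists_relation ht hv
  have hne : q.support.Nonempty := Finsupp.support_nonempty_iff.mpr hq0
  set a := q.support.min' hne with ha
  set b := q.support.max' hne with hb
  have hqa : q a ≠ 0 := Finsupp.mem_support_iff.mp (Finset.min'_mem _ _)
  have hqb : q b ≠ 0 := Finsupp.mem_support_iff.mp (Finset.max'_mem _ _)
  have hle : ∀ i ∈ q.support, a ≤ i := fun i hi => Finset.min'_le _ _ hi
  have hge : ∀ i ∈ q.support, i ≤ b := fun i hi => Finset.le_max' _ _ hi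
  let s : Finset M := (Finset.Ico a b).image fun i => (u ^ i) v
  have hs : ∀ i, a ≤ i → i < b → (u ^ i) v ∈ Submodule.span k[X] (s : Set M) := fun i h1 h2 =>
    Submodule.subset_span (Finset.mem_coe.mpr
      (Finset.mem_image_of_mem (fun i => (u ^ i) v) (Finset.mem_Ico.mpr ⟨h1, h2⟩)))
  have hsW : Submodule.span k[X] (s : Set M) ≤ isolator (Submodule.span k[X] (s : Set M)) :=
    fun x hx => ⟨1, one_ne_zero, by simpa using hx⟩
  have hsum : ∀ j ∈ q.support,
      q j • (u ^ j) v = - ∑ i ∈ q.support.erase j, q i • (u ^ i) v := fun j hj => by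
    rw [← Finset.add_sum_erase _ _ hj] at hq
    exact eq_neg_of_add_eq_zero_left hq
  have hbW : (u ^ b) v ∈ isolator (Submodule.span k[X] (s : Set M)) := by
    refine ⟨q b, hqb, ?_⟩
    rw [hsum b (Finset.max'_mem _ _)]
    refine neg_mem (sum_mem fun i hi => Submodule.smul_mem _ _ ?_)
    obtain ⟨h1, h2⟩ := Finset.mem_erase.mp hi
    exact hs i (hle i h2) (lt_of_le_of_ne (hge i h2) h1)
  have haW : (u ^ (a - 1)) v ∈ isolator (Submodule.span k[X] (s : Set M)) := by
    refine ⟨taylor (-1) (q a), by simpa using hqa, ?_⟩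
    have hinv : ∀ i : ℤ, taylor (-1) (q i) • (u ^ (i - 1)) v = u⁻¹ (q i • (u ^ i) v) := fun i => by
      rw [hu.smul_inv, sub_eq_neg_add, zpow_add, zpow_neg_one, LinearEquiv.mul_apply]
    rw [hinv, hsum a (Finset.min'_mem _ _), map_neg, map_sum]
    refine neg_mem (sum_mem fun i hi => ?_)
    rw [← hinv]
    refine Submodule.smul_mem _ _ ?_
    obtain ⟨h1, h2⟩ := Finset.mem_erase.mp hi
    have h3 := lt_of_le_of_ne (hle i h2) h1.symm
    have h4 := hge i h2
    exact hs _ (by omega) (by omega)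
  refine ⟨s, hu.eq_top _ ?_ ?_ ?_⟩
  · refine (Submodule.ne_bot_iff _).mpr ⟨_, hbW, ?_⟩
    exact (u ^ b).map_ne_zero_iff.mpr hv
  · rintro x ⟨r, hr, hx⟩
    have hstep : ∀ y ∈ Submodule.span k[X] (s : Set M),
        u y ∈ isolator (Submodule.span k[X] (s : Set M)) := fun y hy => by
      induction hy using Submodule.span_induction with
      | mem y hy =>
        obtain ⟨i, hi, rfl⟩ := Finset.mem_image.mp (Finset.mem_coe.mp hy)
        obtain ⟨h1, h2⟩ := Finset.mem_Ico.mp hi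
        have hstep : u ((u ^ i) v) = (u ^ (i + 1)) v := by
          rw [add_comm, zpow_add, zpow_one, LinearEquiv.mul_apply]
        rw [hstep]
        rcases eq_or_lt_of_le (Int.add_one_le_iff.mpr h2) with h | h
        · rw [h]; exact hbW
        · exact hsW (hs _ (by omega) h)
      | zero => simp
      | add x y _ _ hx hy => rw [map_add]; exact add_mem hx hy
      | smul p x _ hx => rw [hu.smul]; exact Submodule.smul_mem _ _ hx
    obtain ⟨t, ht0, hty⟩ := hstep _ hx
    exact ⟨t * taylor 1 r, mul_ne_zero ht0 (by simpa using hr), by rwa [mul_smul, ← hu.smul]⟩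
  · rintro x ⟨r, hr, hx⟩
    have hstep : ∀ y ∈ Submodule.span k[X] (s : Set M),
        u⁻¹ y ∈ isolator (Submodule.span k[X] (s : Set M)) := fun y hy => by
      induction hy using Submodule.span_induction with
      | mem y hy =>
        obtain ⟨i, hi, rfl⟩ := Finset.mem_image.mp (Finset.mem_coe.mp hy)
        obtain ⟨h1, h2⟩ := Finset.mem_Ico.mp hi
        have hstep : u⁻¹ ((u ^ i) v) = (u ^ (i - 1)) v := by
          rw [sub_eq_neg_add, zpow_add, zpow_neg_one, LinearEquiv.mul_apply]
        rw [hstep]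
        rcases eq_or_lt_of_le h1 with h | h
        · rw [← h]; exact haW
        · exact hsW (hs _ (by omega) (by omega))
      | zero => simp
      | add x y _ _ hx hy => rw [map_add]; exact add_mem hx hy
      | smul p x _ hx => rw [hu.smul_inv]; exact Submodule.smul_mem _ _ hx
    obtain ⟨t, ht0, hty⟩ := hstep _ hx
    exact ⟨t * taylor (-1) r, mul_ne_zero ht0 (by simpa using hr),
      by rwa [mul_smul, ← hu.smul_inv]⟩

lemma IsSimpleShift.finite_of_torsionFree [Nontrivial M] (hu : IsSimpleShift u)
    (ht : ∀ (p : k[X]) (v : M), p • v = 0 → p = 0 ∨ v = 0) (D : Submodule k (M →ₗ[k[X]] M))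
    (hD : ∀ φ ∈ D, ∀ v, φ (u v) = u (φ v)) : Module.Finite k D := by
  obtain ⟨s, hs⟩ := hu.exists_fg_isolator_eq_top ht
  let S := Submodule.span k[X] (s : Set M)
  let ev : (M →ₗ[k[X]] M) →ₗ[k[X]] (s → M) :=
    { toFun := fun φ i => φ i
      map_add' := fun _ _ => rfl
      map_smul' := fun _ _ => rfl }
  have hev : LinearMap.ker ev = ⊥ := by
    rw [LinearMap.ker_eq_bot']
    intro φ hφ
    have hS : S ≤ LinearMap.ker φ := Submodule.span_le.mpr fun x hx =>
      congrFun hφ ⟨x, Finset.mem_coe.mp hx⟩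
    ext v
    obtain ⟨q, hq, hv⟩ := (hs ▸ Submodule.mem_top : v ∈ isolator S)
    have h1 : q • φ v = 0 := by rw [← map_smul]; exact hS hv
    exact (ht _ _ h1).resolve_left hq
  let b := Module.Free.chooseBasis k D
  have hli : LinearIndependent k fun i => (b i : M →ₗ[k[X]] M) :=
    b.linearIndependent.map' D.subtype D.ker_subtype
  have hli' := (hu.linearIndependent_polynomial ht (fun i => hD _ (b i).2) hli).map' ev hev
  have hrank : Module.rank k[X] (s → M) < Cardinal.aleph0 :=
    rank_lt_aleph0_of_isolator_eq_top
      (Submodule.fg_pi fun _ => ⟨s, rfl⟩) (isolator_pi_eq_top hs)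
  have hcard := (hli'.cardinal_lift_le_rank).trans_lt (Cardinal.lift_lt_aleph0.mpr hrank)
  have : Finite (Module.Free.ChooseBasisIndex k D) :=
    Cardinal.mk_lt_aleph0_iff.mp (Cardinal.lift_lt_aleph0.mp hcard)
  exact Module.Finite.of_basis b

theorem IsSimpleShift.finite [Nontrivial M] (hu : IsSimpleShift u)
    (D : Submodule k (M →ₗ[k[X]] M)) (hD : ∀ φ ∈ D, ∀ v, φ (u v) = u (φ v)) :
    Module.Finite k D := by
  by_cases ht : ∀ (p : k[X]) (v : M), p • v = 0 → p = 0 ∨ v = 0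
  · exact hu.finite_of_torsionFree ht D hD
  · push Not at ht
    obtain ⟨p, v, h, hp, hv⟩ := ht
    exact hu.finite_of_torsion hp hv h D hD

end ShiftModule

lemma intOp_monomial (n : ℕ) (a : K) :
    intOp K (monomial n a) = monomial (n + 1) (a * ((n : K) + 1)⁻¹) := by
  have h : intOp K (monomial n 1) = ((n : K) + 1)⁻¹ • X ^ (n + 1) := by
    have := (Polynomial.basisMonomials K).constr_basis K
      (fun n => ((n : K) + 1)⁻¹ • (X : K[X]) ^ (n + 1)) n
    rwa [coe_basisMonomials] at this
  have h1 : monomial n a = a • monomial n (1 : K) := by simp [smul_monomial]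
  rw [h1, map_smul, h, ← monomial_one_right_eq_X_pow, smul_monomial, smul_monomial]
  simp

lemma derOp_mul_intOp : derOp K * intOp K = 1 := by
  refine Polynomial.lhom_ext' fun n => LinearMap.ext_ring ?_
  have h : ((n : K) + 1) ≠ 0 := by exact_mod_cast Nat.succ_ne_zero n
  simp [derOp, intOp_monomial, h]

lemma eOp_zero_zero : eOp K 0 0 = 1 - intOp K * derOp K := by
  simp [eOp]

lemma eOp_zero_zero_apply (f : K[X]) : eOp K 0 0 f = C (f.coeff 0) := by
  have : eOp K 0 0 = (monomial 0).comp (lcoeff K 0) := by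
    refine Polynomial.lhom_ext' fun n => LinearMap.ext_ring ?_
    rcases n with _ | n
    · simp [eOp_zero_zero, derOp]
    · have h : ((n : K) + 1) ≠ 0 := by exact_mod_cast Nat.succ_ne_zero n
      have h1 : (n : K) * ((n : K) + 1)⁻¹ + ((n : K) + 1)⁻¹ = 1 := by field_simp
      simp [eOp_zero_zero, derOp, intOp_monomial, coeff_monomial]
      rw [← map_add (monomial (n + 1)), h1, sub_self]
  rw [this]
  simp

lemma intOp_mul_hOp : intOp K * hOp K = xOp K := by
  have h : intOp K * derOp K = 1 - eOp K 0 0 := by rw [eOp_zero_zero]; abel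
  rw [hOp, ← mul_assoc, h]
  ext1 f
  ext1
  simp [sub_mul, eOp_zero_zero_apply, xOp]

lemma derOp_mul_hOp : derOp K * hOp K = (hOp K + 1) * derOp K := by
  refine LinearMap.ext fun f => ?_
  simp only [hOp, derOp, xOp, Module.End.mul_apply, LinearMap.mulLeft_apply, LinearMap.add_apply,
    add_mul, one_mul, derivative_mul, derivative_X, map_add]
  ring

/-- `H` as an element of the ring `I₁`. -/
def hI : I1 K := ⟨hOp K, mul_mem (derOp_mem K) (xOp_mem K)⟩

lemma derI_mul_aeval (p : K[X]) :
    derI K * aeval (hI K) p = aeval (hI K) (taylor 1 p) * derI K := by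
  have hX : derI K * hI K = (hI K + 1) * derI K := Subtype.ext (derOp_mul_hOp K)
  induction p using Polynomial.induction_on' with
  | add p q hp hq => rw [map_add, mul_add, hp, hq, map_add, map_add, add_mul]
  | monomial n a =>
    have h := (show SemiconjBy (derI K) (hI K) (hI K + 1) from hX).pow_right n
    simp only [taylor_monomial, map_mul, map_pow, map_add, aeval_X, aeval_C, aeval_monomial,
      map_one]
    rw [← mul_assoc, ← Algebra.commutes, mul_assoc, h.eq, mul_assoc]

lemma eI_mul_mul_eI (a : I1 K) : ∃ c : K, eI K 0 0 * a * eI K 0 0 = c • eI K 0 0 := by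
  refine ⟨((a : Module.End K K[X]) 1).coeff 0, Subtype.ext (LinearMap.ext fun f => ?_)⟩
  have h : C (f.coeff 0) = f.coeff 0 • (1 : K[X]) := by rw [smul_eq_C_mul, mul_one]
  change eOp K 0 0 ((a : Module.End K K[X]) (eOp K 0 0 f)) =
    ((a : Module.End K K[X]) 1).coeff 0 • eOp K 0 0 f
  rw [eOp_zero_zero_apply, eOp_zero_zero_apply, h, map_smul, coeff_smul, smul_eq_mul, C_mul,
    smul_eq_C_mul, smul_eq_C_mul, mul_one, mul_comm]

section Modules

variable {K} {M : Type*} [AddCommGroup M] [Module (I1 K) M] [Module K M] [IsScalarTower K (I1 K) M]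

lemma smul_mem_of_generators (N : Submodule K M)
    (hh : ∀ v ∈ N, hI K • v ∈ N) (hd : ∀ v ∈ N, derI K • v ∈ N) (hi : ∀ v ∈ N, intI K • v ∈ N)
    (a : I1 K) {v : M} (hv : v ∈ N) : a • v ∈ N := by
  obtain ⟨a, ha⟩ := a
  induction ha using Algebra.adjoin_induction generalizing v with
  | mem x hx =>
    rcases hx with rfl | rfl | rfl
    · have : (⟨xOp K, xOp_mem K⟩ : I1 K) = intI K * hI K := Subtype.ext (intOp_mul_hOp K).symm
      change (⟨xOp K, xOp_mem K⟩ : I1 K) • v ∈ N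
      rw [this, mul_smul]
      exact hi _ (hh _ hv)
    · exact hd _ hv
    · exact hi _ hv
  | algebraMap c =>
    change (algebraMap K (I1 K) c) • v ∈ N
    rw [algebraMap_smul]
    exact N.smul_mem c hv
  | add x y hx hy h1 h2 =>
    change ((⟨x, hx⟩ + ⟨y, hy⟩ : I1 K)) • v ∈ N
    rw [add_smul]
    exact add_mem (h1 hv) (h2 hv)
  | mul x y hx hy h1 h2 =>
    change ((⟨x, hx⟩ * ⟨y, hy⟩ : I1 K)) • v ∈ N
    rw [mul_smul]
    exact h1 (h2 hv)

variable [SMulCommClass (I1 K) K M]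

lemma finite_end_of_eI_smul_ne_zero (hM : IsSimpleModule (I1 K) M) {v : M}
    (hv : eI K 0 0 • v ≠ 0) : Module.Finite K (M →ₗ[I1 K] M) := by
  have hidem : eI K 0 0 * eI K 0 0 = eI K 0 0 := by
    refine Subtype.ext (LinearMap.ext fun f => ?_)
    change eOp K 0 0 (eOp K 0 0 f) = eOp K 0 0 f
    simp [eOp_zero_zero_apply]
  have hspan : Submodule.span (I1 K) {eI K 0 0 • v} = ⊤ :=
    IsSimpleModule.span_singleton_eq_top (I1 K) hv
  let ev : (M →ₗ[I1 K] M) →ₗ[K] M :=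
    { toFun := fun φ => φ (eI K 0 0 • v)
      map_add' := fun _ _ => rfl
      map_smul' := fun _ _ => rfl }
  have hev : ∀ φ, ev φ ∈ Submodule.span K {eI K 0 0 • v} := by
    intro φ
    obtain ⟨a, ha⟩ := Submodule.mem_span_singleton.mp
      (hspan ▸ Submodule.mem_top : φ (eI K 0 0 • v) ∈ Submodule.span (I1 K) {eI K 0 0 • v})
    obtain ⟨c, hc⟩ := eI_mul_mul_eI K a
    refine Submodule.mem_span_singleton.mpr ⟨c, ?_⟩
    change c • eI K 0 0 • v = φ (eI K 0 0 • v)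
    have h1 : φ (eI K 0 0 • v) = eI K 0 0 • φ (eI K 0 0 • v) := by
      rw [← map_smul, ← mul_smul, hidem]
    rw [h1, ← ha, ← mul_smul, ← mul_smul, hc, smul_assoc]
  refine Module.Finite.of_injective (ev.codRestrict _ hev) ?_
  rw [← LinearMap.ker_eq_bot, LinearMap.ker_codRestrict, LinearMap.ker_eq_bot']
  intro φ hφ
  rw [← LinearMap.ker_eq_top, eq_top_iff, ← hspan, Submodule.span_singleton_le_iff_mem]
  exact hφ

lemma finite_end_of_eI_smul_eq_zero (hM : IsSimpleModule (I1 K) M)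
    (h0 : ∀ v : M, eI K 0 0 • v = 0) : Module.Finite K (M →ₗ[I1 K] M) := by
  have : Nontrivial M := IsSimpleModule.nontrivial (I1 K) M
  let _ : Module K[X] M := Module.compHom M (aeval (hI K) : K[X] →ₐ[K] I1 K).toRingHom
  have hsmul : ∀ (p : K[X]) (v : M), p • v = aeval (hI K) p • v := fun _ _ => rfl
  have : IsScalarTower K K[X] M := ⟨fun a p v => by rw [hsmul, hsmul, map_smul, smul_assoc]⟩
  have hdi : derI K * intI K = 1 := Subtype.ext (derOp_mul_intOp K)
  have hid : intI K * derI K + eI K 0 0 = 1 := Subtype.ext (by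
    change intOp K * derOp K + eOp K 0 0 = 1
    rw [eOp_zero_zero]; abel)
  let u : M ≃ₗ[K] M :=
    { toFun := fun v => derI K • v
      invFun := fun v => intI K • v
      map_add' := smul_add _
      map_smul' := fun c v => smul_comm _ c v
      left_inv := fun v => by
        change intI K • derI K • v = v
        rw [← mul_smul, ← add_zero ((intI K * derI K) • v), ← h0 v, ← add_smul, hid, one_smul]
      right_inv := fun v => by
        change derI K • intI K • v = v
        rw [← mul_smul, hdi, one_smul] }
  have hu : ShiftModule.IsSimpleShift u :=
    { smul := fun p v => by
        change derI K • p • v = taylor 1 p • derI K • v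
        rw [hsmul, hsmul, ← mul_smul, ← mul_smul, derI_mul_aeval]
      eq_top := fun N hN hd hi => by
        let N' : Submodule (I1 K) M :=
          { N with
            smul_mem' := fun a v hv => smul_mem_of_generators (N.restrictScalars K)
              (fun v hv => by
                have := N.smul_mem X hv
                rwa [hsmul, aeval_X] at this) hd hi a hv }
        rcases hM.toIsSimpleOrder.eq_bot_or_eq_top N' with h | h
        · refine absurd ((Submodule.eq_bot_iff _).mpr fun x hx => ?_) hN
          exact (Submodule.eq_bot_iff _).mp h x hx
        · refine Submodule.eq_top_iff'.mpr fun x => ?_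
          exact Submodule.eq_top_iff'.mp h x }
  let ρ : (M →ₗ[I1 K] M) →ₗ[K] (M →ₗ[K[X]] M) :=
    { toFun := fun φ =>
        { toFun := φ
          map_add' := φ.map_add
          map_smul' := fun p v => φ.map_smul (aeval (hI K) p) v }
      map_add' := fun _ _ => rfl
      map_smul' := fun _ _ => rfl }
  have hρ : Function.Injective ρ := fun φ ψ h => LinearMap.ext fun v => LinearMap.congr_fun h v
  have : Module.Finite K (LinearMap.range ρ) := hu.finite _ (by
    rintro _ ⟨φ, rfl⟩ v
    exact φ.map_smul (derI K) v)
  exact Module.Finite.equiv (LinearEquiv.ofInjective ρ hρ).symm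

end Modules

/-- the endomorphism ring of every simple left `I₁`-module is a
finite-dimensional `K`-vector space. -/
theorem statement3 (M : Type*) [AddCommGroup M] [Module (I1 K) M]
    [Module K M] [IsScalarTower K (I1 K) M] [SMulCommClass (I1 K) K M]
    (hM : IsSimpleModule (I1 K) M) :
    FiniteDimensional K (M →ₗ[I1 K] M) := by
  by_cases h : ∀ v : M, eI K 0 0 • v = 0
  · exact finite_end_of_eI_smul_eq_zero hM h
  · push Not at h
    obtain ⟨v, hv⟩ := h
    exact finite_end_of_eI_smul_ne_zero hM hv

end
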